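/- arXiv:1706.07354 — 2 statements merged into one kernel-verified Lean document; each statement's English description precedes it below -/
import Mathlib

section
/- Let k be a field and let K = k((u))((t)) be the field of iterated Laurent series. For nonzero f, g ∈ K define ν_K(f, g) := ord_u( coefficient of t^0 in f^{ord_t g} · g^{−ord_t f} ) ∈ ℤ (integer powers taken in the field K). Then ν_K is bimultiplicative: for all nonzero f₁, f₂, g, f, g₁, g₂ ∈ K one has ν_K(f₁·f₂, g) = ν_K(f₁, g) + ν_K(f₂, g) and ν_K(f, g₁·g₂) = ν_K(f, g₁) + ν_K(f, g₂). -/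
/-- Parshin's pairing on the two-dimensional local field `K = k((u))((t))`:
`ν_K(f, g) = ord_u` of the coefficient of `t^0` in `f^(ord_t g) · g^(−ord_t f)`. -/
noncomputable def nuK {k : Type*} [Field k]
    (f g : LaurentSeries (LaurentSeries k)) : ℤ :=
  ((f ^ g.order * g ^ (-f.order)).coeff 0).order

/-- An integer-valued function on a field that is additive on products of nonzero elements
turns integer powers into multiples. -/
theorem map_zpow_of_map_mul_eq_add {F : Type*} [Field F] {v : F → ℤ}
    (hv : ∀ x y : F, x ≠ 0 → y ≠ 0 → v (x * y) = v x + v y) {x : F} (hx : x ≠ 0) (n : ℤ) :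
    v (x ^ n) = n * v x := by
  induction n with
  | zero =>
    have h := hv 1 1 one_ne_zero one_ne_zero
    rw [mul_one] at h
    rw [zpow_zero]
    lia
  | succ n ih =>
    rw [zpow_add_one₀ hx, hv _ _ (zpow_ne_zero _ hx) hx, ih]
    ring
  | pred n ih =>
    have h := hv (x ^ (-(n : ℤ) - 1)) x (zpow_ne_zero _ hx) hx
    rw [← zpow_add_one₀ hx, sub_add_cancel, ih] at h
    linarith

theorem HahnSeries.order_leadingCoeff_mul {k : Type*} [Field k]
    {f g : LaurentSeries (LaurentSeries k)} (hf : f ≠ 0) (hg : g ≠ 0) :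
    (f * g).leadingCoeff.order = f.leadingCoeff.order + g.leadingCoeff.order := by
  rw [HahnSeries.leadingCoeff_mul, HahnSeries.order_mul] <;>
    simpa [HahnSeries.leadingCoeff_eq_zero]

theorem nuK_eq_sub {k : Type*} [Field k] {f g : LaurentSeries (LaurentSeries k)}
    (hf : f ≠ 0) (hg : g ≠ 0) :
    nuK f g = g.order * f.leadingCoeff.order - f.order * g.leadingCoeff.order := by
  have hfn := zpow_ne_zero g.order hf
  have hgn := zpow_ne_zero (-f.order) hg
  have hord : (f ^ g.order * g ^ (-f.order)).order = 0 := by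
    have h {x : LaurentSeries (LaurentSeries k)} (hx : x ≠ 0) (n : ℤ) :
        (x ^ n).order = n * x.order :=
      map_zpow_of_map_mul_eq_add (v := HahnSeries.order)
        (fun _ _ => HahnSeries.order_mul) hx n
    rw [HahnSeries.order_mul hfn hgn, h hf, h hg]
    ring
  have h {x : LaurentSeries (LaurentSeries k)} (hx : x ≠ 0) (n : ℤ) :
      (x ^ n).leadingCoeff.order = n * x.leadingCoeff.order :=
    map_zpow_of_map_mul_eq_add (v := fun y : LaurentSeries (LaurentSeries k) =>
      y.leadingCoeff.order) (fun _ _ => HahnSeries.order_leadingCoeff_mul) hx n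
  rw [nuK, ← hord, ← HahnSeries.leadingCoeff_eq, HahnSeries.order_leadingCoeff_mul hfn hgn,
    h hf, h hg]
  ring

/-- On `K = k((u))((t))`, Parshin's pairing `ν_K` is bimultiplicative:
`ν_K(f₁·f₂, g) = ν_K(f₁, g) + ν_K(f₂, g)` and
`ν_K(f, g₁·g₂) = ν_K(f, g₁) + ν_K(f, g₂)` for nonzero arguments. -/
theorem nuK_bimultiplicative {k : Type*} [Field k] :
    (∀ f₁ f₂ g : LaurentSeries (LaurentSeries k), f₁ ≠ 0 → f₂ ≠ 0 → g ≠ 0 →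
      nuK (f₁ * f₂) g = nuK f₁ g + nuK f₂ g) ∧
    (∀ f g₁ g₂ : LaurentSeries (LaurentSeries k), f ≠ 0 → g₁ ≠ 0 → g₂ ≠ 0 →
      nuK f (g₁ * g₂) = nuK f g₁ + nuK f g₂) := by
  refine ⟨fun f₁ f₂ g hf₁ hf₂ hg => ?_, fun f g₁ g₂ hf hg₁ hg₂ => ?_⟩
  · rw [nuK_eq_sub (mul_ne_zero hf₁ hf₂) hg, nuK_eq_sub hf₁ hg, nuK_eq_sub hf₂ hg,
      HahnSeries.order_mul hf₁ hf₂, HahnSeries.order_leadingCoeff_mul hf₁ hf₂]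
    ring
  · rw [nuK_eq_sub hf (mul_ne_zero hg₁ hg₂), nuK_eq_sub hf hg₁, nuK_eq_sub hf hg₂,
      HahnSeries.order_mul hg₁ hg₂, HahnSeries.order_leadingCoeff_mul hg₁ hg₂]
    ring
end

section
/- Let k be a field and let K = k((u))((t)) be the field of iterated Laurent series. For nonzero f, g ∈ K define ν_K(f, g) := ord_u( coefficient of t^0 in f^{ord_t g} · g^{−ord_t f} ) ∈ ℤ (integer powers taken in the field K). Then ν_K is alternating and antisymmetric: for all nonzero f, g ∈ K one has ν_K(f, f) = 0 and ν_K(f, g) = −ν_K(g, f). -/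
namespace HahnSeries

variable {Γ R : Type*} [AddCommGroup Γ] [LinearOrder Γ] [IsOrderedAddMonoid Γ] [Field R]

theorem order_inv_of_field (x : HahnSeries Γ R) : x⁻¹.order = -x.order := by
  rcases eq_or_ne x 0 with rfl | hx
  · simp
  · have h := order_mul hx (inv_ne_zero hx)
    rw [mul_inv_cancel₀ hx, order_one] at h
    exact (neg_eq_of_add_eq_zero_right h.symm).symm

theorem order_zpow_of_field (x : HahnSeries Γ R) (n : ℤ) : (x ^ n).order = n • x.order := by
  cases n with
  | ofNat n => simp
  | negSucc n => rw [zpow_negSucc, order_inv_of_field, order_pow, negSucc_zsmul]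

theorem coeff_zero_inv_of_order_eq_zero {x : HahnSeries Γ R} (hx : x ≠ 0) (h : x.order = 0) :
    x⁻¹.coeff 0 = (x.coeff 0)⁻¹ := by
  have hmul := coeff_mul_order_add_order x x⁻¹
  rw [leadingCoeff_eq, leadingCoeff_eq, order_inv_of_field, h, neg_zero, add_zero,
    mul_inv_cancel₀ hx, coeff_one, if_pos rfl] at hmul
  exact eq_inv_of_mul_eq_one_right hmul.symm

end HahnSeries

/-- On `K = k((u))((t))`, Parshin's pairing `ν_K` is alternating and antisymmetric:
`ν_K(f, f) = 0` and `ν_K(f, g) = −ν_K(g, f)` for nonzero `f, g`. -/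
theorem nuK_alternating {k : Type*} [Field k]
    (f g : LaurentSeries (LaurentSeries k)) (hf : f ≠ 0) (hg : g ≠ 0) :
    nuK f f = 0 ∧ nuK f g = -nuK g f := by
  have hne : f ^ g.order * g ^ (-f.order) ≠ 0 :=
    mul_ne_zero (zpow_ne_zero _ hf) (zpow_ne_zero _ hg)
  have hord : (f ^ g.order * g ^ (-f.order)).order = 0 := by
    rw [HahnSeries.order_mul (zpow_ne_zero _ hf) (zpow_ne_zero _ hg),
      HahnSeries.order_zpow_of_field, HahnSeries.order_zpow_of_field, smul_eq_mul, smul_eq_mul]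
    ring
  have hswap : g ^ f.order * f ^ (-g.order) = (f ^ g.order * g ^ (-f.order))⁻¹ := by
    rw [mul_inv, zpow_neg, zpow_neg, inv_inv, mul_comm]
  constructor
  · rw [nuK, zpow_neg, mul_inv_cancel₀ (zpow_ne_zero _ hf), HahnSeries.coeff_one, if_pos rfl,
      HahnSeries.order_one]
  · rw [nuK, nuK, hswap, HahnSeries.coeff_zero_inv_of_order_eq_zero hne hord,
      HahnSeries.order_inv_of_field, neg_neg]
end
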